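/- arXiv:1910.03917 — 2 statements merged into one kernel-verified Lean document; each statement's English description precedes it below -/
import Mathlib

section
/- If S(η) is a clause set cycle over a language L containing 0 and s, then every model of the theory I∃₁(L) of induction for ∃₁ formulas satisfies ∀x ¬S(x). -/
open FirstOrder Language Structure

universe u v w u'

namespace ClauseSetCycles

variable {L : FirstOrder.Language.{u, v}}

/-- A literal is an atomic formula or the negation of an atomic formula. -/
inductive IsLiteral {α : Type u'} : ∀ {n : ℕ}, L.BoundedFormula α n → Prop
  | atom {n} {φ : L.BoundedFormula α n} : φ.IsAtomic → IsLiteral φ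
  | negAtom {n} {φ : L.BoundedFormula α n} : φ.IsAtomic → IsLiteral φ.not

/-- A disjunction of literals (identifying, as usual, a formula such as
`a₁ → (b₁ ∨ b₂)` with its negation normal form `¬a₁ ∨ b₁ ∨ b₂`). -/
inductive IsClauseMatrix {α : Type u'} : ∀ {n : ℕ}, L.BoundedFormula α n → Prop
  | lit {n} {φ : L.BoundedFormula α n} : IsLiteral φ → IsClauseMatrix φ
  | sup {n} {φ ψ : L.BoundedFormula α n} :
      IsClauseMatrix φ → IsClauseMatrix ψ → IsClauseMatrix (φ ⊔ ψ)
  | impAtom {n} {φ ψ : L.BoundedFormula α n} :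
      φ.IsAtomic → IsClauseMatrix ψ → IsClauseMatrix (φ.imp ψ)

/-- A clause is a universally quantified disjunction of literals. -/
inductive IsClause {α : Type u'} : ∀ {n : ℕ}, L.BoundedFormula α n → Prop
  | matrix {n} {φ : L.BoundedFormula α n} : IsClauseMatrix φ → IsClause φ
  | all {n} {φ : L.BoundedFormula α (n + 1)} : IsClause φ → IsClause φ.all

/-- A clause set is a conjunction of clauses. -/
inductive IsClauseSet {α : Type u'} : ∀ {n : ℕ}, L.BoundedFormula α n → Prop
  | clause {n} {φ : L.BoundedFormula α n} : IsClause φ → IsClauseSet φ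
  | inf {n} {φ ψ : L.BoundedFormula α n} :
      IsClauseSet φ → IsClauseSet ψ → IsClauseSet (φ ⊓ ψ)

/-- An `∃₁` formula: a quantifier-free formula preceded by a block of
existential quantifiers. -/
inductive IsExistsQF {α : Type u'} : ∀ {n : ℕ}, L.BoundedFormula α n → Prop
  | of_isQF {n} {φ : L.BoundedFormula α n} : φ.IsQF → IsExistsQF φ
  | ex {n} {φ : L.BoundedFormula α (n + 1)} : IsExistsQF φ → IsExistsQF φ.ex

variable (zero : L.Constants) (succ : L.Functions 1)

/-- The interpretation of the successor symbol in a structure. -/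
def sFun {M : Type w} [L.Structure M] (a : M) : M :=
  funMap succ ![a]

/-- The interpretation of the zero symbol in a structure. -/
def zElt (M : Type w) [L.Structure M] : M :=
  funMap zero ![]

/-- The interpretation of the numeral `s^k(0)` in a structure. -/
def numElt (M : Type w) [L.Structure M] (k : ℕ) : M :=
  (sFun succ)^[k] (zElt zero M)

/-- Universal quantification of the distinguished (`Sum.inr`) free variable. -/
def close1 {α : Type u'} (φ : L.Formula (α ⊕ Fin 1)) : L.Formula α :=
  (BoundedFormula.relabel (Sum.elim Sum.inl (fun _ => Sum.inr (0 : Fin 1))) φ).all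

/-- Universal closure of a formula with finitely many free variables. -/
def closeAll {k : ℕ} (φ : L.Formula (Fin k)) : L.Sentence :=
  (BoundedFormula.relabel (fun i => (Sum.inr i : Empty ⊕ Fin k)) φ).alls

/-- The induction axiom `Ind_x ψ` for a formula `ψ(x, z̄)`, where the
induction variable `x` is the `Sum.inr` variable and the parameters
`z̄` are the `Sum.inl` variables:
`∀ z̄ (ψ(0,z̄) → ∀x (ψ(x,z̄) → ψ(s(x),z̄)) → ∀x ψ(x,z̄))`. -/
def indAxiom {k : ℕ} (ψ : L.Formula (Fin k ⊕ Fin 1)) : L.Sentence :=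
  closeAll
    ((ψ.subst (Sum.elim Term.var fun _ => Constants.term zero)).imp
      ((close1 (ψ.imp
          (ψ.subst (Sum.elim (fun i => Term.var (Sum.inl i))
            fun _ => Functions.apply₁ succ (Term.var (Sum.inr 0)))))).imp
        (close1 ψ)))

/-- The theory `I∃₁(L)` of induction for `∃₁` formulas. -/
def IndE1 : L.Theory :=
  { σ | ∃ (k : ℕ) (ψ : L.Formula (Fin k ⊕ Fin 1)), IsExistsQF ψ ∧ σ = indAxiom zero succ ψ }

/-- The theory `IOpen(L)` of induction for quantifier-free formulas. -/
def IOpenTh : L.Theory :=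
  { σ | ∃ (k : ℕ) (ψ : L.Formula (Fin k ⊕ Fin 1)), ψ.IsQF ∧ σ = indAxiom zero succ ψ }

end ClauseSetCycles

namespace ClauseSetCycles

section

open BoundedFormula

variable {L : FirstOrder.Language.{u, v}} {α : Type u'} {β : Type*} {n : ℕ}

theorem IsExistsQF.castLE {l : ℕ} {φ : L.BoundedFormula α l} (hφ : IsExistsQF φ) :
    ∀ {n : ℕ} (h : l ≤ n), IsExistsQF (φ.castLE h) := by
  induction hφ with
  | of_isQF h => exact fun _ => .of_isQF h.castLE
  | ex _ ih => exact fun _ => .ex (ih _)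

theorem IsExistsQF.liftAt {φ : L.BoundedFormula α n} (hφ : IsExistsQF φ) (k m : ℕ) :
    IsExistsQF (φ.liftAt k m) := by
  induction hφ with
  | of_isQF h => exact .of_isQF h.liftAt
  | ex _ ih => exact .ex (ih.castLE _)

theorem IsExistsQF.relabel {m : ℕ} {φ : L.BoundedFormula α m} (hφ : IsExistsQF φ)
    (f : α → β ⊕ Fin n) : IsExistsQF (φ.relabel f) := by
  induction hφ with
  | of_isQF h => exact .of_isQF (h.relabel f)
  | ex _ ih => rw [relabel_ex]; exact .ex ih

/-- In a nonempty structure, a disjunction of a quantifier-free formula and an `∃₁` formula is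
equivalent to an `∃₁` formula. -/
theorem exists_isExistsQF_isQF_sup (M : Type w) [L.Structure M] [Nonempty M]
    {φ ψ : L.BoundedFormula α n} (hφ : φ.IsQF) (hψ : IsExistsQF ψ) :
    ∃ χ : L.BoundedFormula α n, IsExistsQF χ ∧
      ∀ (v : α → M) (xs : Fin n → M), χ.Realize v xs ↔ φ.Realize v xs ∨ ψ.Realize v xs := by
  induction hψ with
  | of_isQF h => exact ⟨_, .of_isQF (hφ.sup h), fun _ _ => realize_sup⟩
  | @ex n ψ _ ih =>
    obtain ⟨χ, hχ, h⟩ := ih (hφ.liftAt (k := 1) (m := n))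
    exact ⟨χ.ex, hχ.ex, fun v xs => by simp [h, exists_or]⟩

/-- In a nonempty structure, a disjunction of two `∃₁` formulas is equivalent to an `∃₁`
formula. -/
theorem exists_isExistsQF_sup (M : Type w) [L.Structure M] [Nonempty M]
    {φ ψ : L.BoundedFormula α n} (hφ : IsExistsQF φ) (hψ : IsExistsQF ψ) :
    ∃ χ : L.BoundedFormula α n, IsExistsQF χ ∧
      ∀ (v : α → M) (xs : Fin n → M), χ.Realize v xs ↔ φ.Realize v xs ∨ ψ.Realize v xs := by
  induction hφ with
  | of_isQF h => exact exists_isExistsQF_isQF_sup M h hψ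
  | @ex n φ _ ih =>
    obtain ⟨χ, hχ, h⟩ := ih (hψ.liftAt 1 n)
    exact ⟨χ.ex, hχ.ex, fun v xs => by simp [h, exists_or]⟩

theorem IsLiteral.isQF {φ : L.BoundedFormula α n} (h : IsLiteral φ) : φ.IsQF := by
  cases h with
  | atom h => exact h.isQF
  | negAtom h => exact h.isQF.not

theorem IsClauseMatrix.isQF {φ : L.BoundedFormula α n} (h : IsClauseMatrix φ) : φ.IsQF := by
  induction h with
  | lit h => exact h.isQF
  | sup _ _ ih₁ ih₂ => exact ih₁.sup ih₂
  | impAtom h _ ih => exact h.isQF.imp ih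

/-- The negation of a clause is equivalent to an `∃₁` formula. -/
theorem IsClause.exists_isExistsQF_not (M : Type w) [L.Structure M]
    {φ : L.BoundedFormula α n} (hφ : IsClause φ) :
    ∃ χ : L.BoundedFormula α n, IsExistsQF χ ∧
      ∀ (v : α → M) (xs : Fin n → M), χ.Realize v xs ↔ ¬ φ.Realize v xs := by
  induction hφ with
  | matrix h => exact ⟨_, .of_isQF h.isQF.not, fun _ _ => realize_not⟩
  | all _ ih =>
    obtain ⟨χ, hχ, h⟩ := ih
    exact ⟨χ.ex, hχ.ex, fun v xs => by simp [h]⟩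

/-- In a nonempty structure, the negation of a clause set is equivalent to an `∃₁` formula. -/
theorem IsClauseSet.exists_isExistsQF_not (M : Type w) [L.Structure M] [Nonempty M]
    {φ : L.BoundedFormula α n} (hφ : IsClauseSet φ) :
    ∃ χ : L.BoundedFormula α n, IsExistsQF χ ∧
      ∀ (v : α → M) (xs : Fin n → M), χ.Realize v xs ↔ ¬ φ.Realize v xs := by
  induction hφ with
  | clause h => exact h.exists_isExistsQF_not M
  | inf _ _ ih₁ ih₂ =>
    obtain ⟨χ₁, hχ₁, h₁⟩ := ih₁
    obtain ⟨χ₂, hχ₂, h₂⟩ := ih₂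
    obtain ⟨χ, hχ, h⟩ := exists_isExistsQF_sup M hχ₁ hχ₂
    exact ⟨χ, hχ, fun v xs => by rw [h, h₁, h₂, realize_inf, not_and_or]⟩

theorem realize_closeAll {M : Type w} [L.Structure M] {k : ℕ} {φ : L.Formula (Fin k)} :
    M ⊨ closeAll φ ↔ ∀ z : Fin k → M, φ.Realize z :=
  realize_alls.trans (forall_congr' fun _ => Formula.realize_relabel_sumInr φ)

theorem realize_close1 {M : Type w} [L.Structure M] {φ : L.Formula (α ⊕ Fin 1)} {v : α → M} :
    (close1 φ).Realize v ↔ ∀ a : M, φ.Realize (Sum.elim v fun _ => a) := by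
  refine forall_congr' fun a => ?_
  rw [BoundedFormula.realize_relabel, Formula.Realize]
  refine iff_of_eq (congrArg₂ (BoundedFormula.Realize φ) ?_ (Subsingleton.elim _ _))
  funext i
  rcases i with i | i
  · rfl
  · rfl

/-- The induction axiom for `ψ` holds in a structure if and only if the structure satisfies induction
for `ψ` under every assignment of the parameters. -/
theorem realize_indAxiom {zero : L.Constants} {succ : L.Functions 1} {M : Type w}
    [L.Structure M] {k : ℕ} {ψ : L.Formula (Fin k ⊕ Fin 1)} :
    M ⊨ indAxiom zero succ ψ ↔ ∀ z : Fin k → M,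
      ψ.Realize (Sum.elim z fun _ => zElt zero M) →
      (∀ a : M, ψ.Realize (Sum.elim z fun _ => a) →
        ψ.Realize (Sum.elim z fun _ => sFun succ a)) →
      ∀ a : M, ψ.Realize (Sum.elim z fun _ => a) := by
  rw [indAxiom, realize_closeAll]
  refine forall_congr' fun z => ?_
  rw [Formula.realize_imp, Formula.realize_imp, realize_close1, realize_close1]
  refine imp_congr ?_ (imp_congr (forall_congr' fun a => ?_) Iff.rfl)
  · rw [Formula.Realize, realize_subst]
    refine iff_of_eq (congrArg₂ (BoundedFormula.Realize ψ) ?_ rfl)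
    funext i
    rcases i with i | i
    · rfl
    · exact Term.realize_constants.trans funMap_eq_coe_constants.symm
  · rw [Formula.realize_imp]
    refine imp_congr Iff.rfl ?_
    rw [Formula.Realize, realize_subst]
    refine iff_of_eq (congrArg₂ (BoundedFormula.Realize ψ) ?_ rfl)
    funext i
    rcases i with i | i
    · rfl
    · exact Term.realize_functions_apply₁

end

/-- If `S(η)` is a clause set cycle over a language `L` containing `0` and `s`
(i.e. `S(s(η)) ⊨ S(η)` and `S(0) ⊨ ⊥`), then every model of the theory `I∃₁(L)` of induction
for `∃₁` formulas satisfies `∀x ¬S(x)`. -/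
theorem statement1 {L : FirstOrder.Language.{u, v}} (zero : L.Constants) (succ : L.Functions 1)
    (S : L.Formula Unit) (hS : IsClauseSet S)
    -- `S(s(η)) ⊨ S(η)`
    (hstep : ∀ (M : Type w) [L.Structure M] [Nonempty M] (a : M),
      S.Realize (fun _ => sFun succ a) → S.Realize (fun _ => a))
    -- `S(0) ⊨ ⊥`
    (hzero : ∀ (M : Type w) [L.Structure M] [Nonempty M],
      ¬ S.Realize (fun _ => zElt zero M))
    -- every model of `I∃₁(L)` satisfies `∀x ¬S(x)`
    (M : Type w) [L.Structure M] [Nonempty M] (hM : M ⊨ IndE1 zero succ) (a : M) :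
    ¬ S.Realize (fun _ => a) := by
  obtain ⟨χ, hχ, h⟩ := hS.exists_isExistsQF_not M
  let ψ : L.Formula (Fin 0 ⊕ Fin 1) := Formula.relabel (fun _ => Sum.inr 0) χ
  have hψ : ∀ (z : Fin 0 → M) (b : M),
      ψ.Realize (Sum.elim z fun _ => b) ↔ ¬ S.Realize fun _ => b :=
    fun z b => Formula.realize_relabel.trans (h _ _)
  have hind := realize_indAxiom.1
    (Theory.model_iff _ |>.1 hM _ ⟨0, ψ, hχ.relabel _, rfl⟩) Fin.elim0
  simp only [hψ] at hind
  exact hind (hzero M) (fun b hb hsb => hb (hstep M b hsb)) a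

end ClauseSetCycles
end

section
/- For every L_▷-formula φ: T_▷ + IOpen(L_▷) ⊢ φ if and only if T_▷^I ⊢ φ. In particular, the theory T_▷ + IOpen(L_▷) is finitely axiomatized by the universal theory T_▷^I. -/
open FirstOrder Language Structure

universe u v u'

namespace TriangularNumbers

/-- The function symbols of the language `L_▷`: `0`, `s`, `p`, `+`. -/
inductive TriFunc : ℕ → Type
  | zero : TriFunc 0
  | succ : TriFunc 1
  | pred : TriFunc 1
  | plus : TriFunc 2

/-- The relation symbols of the language `L_▷`: the binary symbol `▷`. -/
inductive TriRel : ℕ → Type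
  | tri : TriRel 2

/-- The language `L_▷` with function symbols `0`, `s`, `p`, `+` and a binary
predicate symbol `▷`. -/
def LTri : FirstOrder.Language := ⟨TriFunc, TriRel⟩

def fZero : LTri.Constants := TriFunc.zero
def fSucc : LTri.Functions 1 := TriFunc.succ
def fPred : LTri.Functions 1 := TriFunc.pred
def fPlus : LTri.Functions 2 := TriFunc.plus
def rTri : LTri.Relations 2 := TriRel.tri

/-- The term `0`. -/
def zT {α : Type u'} : LTri.Term α := Constants.term fZero
/-- The term `s(t)`. -/
def sT {α : Type u'} (t : LTri.Term α) : LTri.Term α := Functions.apply₁ fSucc t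
/-- The term `p(t)`. -/
def pT {α : Type u'} (t : LTri.Term α) : LTri.Term α := Functions.apply₁ fPred t
/-- The term `t + u`. -/
def aT {α : Type u'} (t u : LTri.Term α) : LTri.Term α := Functions.apply₂ fPlus t u

/-- (A1) `∀x s(x) ≠ 0`. -/
def axA1 : LTri.Sentence := ∀' ∼(sT &0 =' zT)
/-- (A2) `p(0) = 0`. -/
def axA2 : LTri.Sentence := pT zT =' zT
/-- (A3) `∀x p(s(x)) = x`. -/
def axA3 : LTri.Sentence := ∀' (pT (sT &0) =' &0)
/-- (A4) `∀x x + 0 = x`. -/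
def axA4 : LTri.Sentence := ∀' (aT &0 zT =' &0)
/-- (A5) `∀x∀y x + s(y) = s(x + y)`. -/
def axA5 : LTri.Sentence := ∀' ∀' (aT &0 (sT &1) =' sT (aT &0 &1))
/-- (A6) `0 ▷ 0`. -/
def axA6 : LTri.Sentence := rTri.boundedFormula₂ zT zT
/-- (A7) `∀x∀y (x ▷ y → s(x) ▷ s(x) + y)`. -/
def axA7 : LTri.Sentence :=
  ∀' ∀' (rTri.boundedFormula₂ &0 &1 ⟹ rTri.boundedFormula₂ (sT &0) (aT (sT &0) &1))
/-- (A8) `∀x∀y (s(x) ▷ s(x) + y → x ▷ y)`. -/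
def axA8 : LTri.Sentence :=
  ∀' ∀' (rTri.boundedFormula₂ (sT &0) (aT (sT &0) &1) ⟹ rTri.boundedFormula₂ &0 &1)
/-- (A9) `∀x∀y∀z (x ▷ y ∧ x ▷ z → y = z)`. -/
def axA9 : LTri.Sentence :=
  ∀' ∀' ∀' ((rTri.boundedFormula₂ &0 &1 ⊓ rTri.boundedFormula₂ &0 &2) ⟹ (&1 =' &2))

/-- The theory `T_▷`, axiomatized by (A1)–(A9). -/
def TTri : LTri.Theory := {axA1, axA2, axA3, axA4, axA5, axA6, axA7, axA8, axA9}

/-- (B1) `∀x (x ≠ 0 → x = s(p(x)))`. -/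
def axB1 : LTri.Sentence := ∀' (∼(&0 =' zT) ⟹ (&0 =' sT (pT &0)))
/-- (B2) `∀x∀y x + y = y + x`. -/
def axB2 : LTri.Sentence := ∀' ∀' (aT &0 &1 =' aT &1 &0)
/-- (B3) `∀x∀y∀z (x+y)+z = x+(y+z)`. -/
def axB3 : LTri.Sentence := ∀' ∀' ∀' (aT (aT &0 &1) &2 =' aT &0 (aT &1 &2))
/-- (B4) `∀x∀y∀z (x+y = x+z → y = z)`. -/
def axB4 : LTri.Sentence := ∀' ∀' ∀' ((aT &0 &1 =' aT &0 &2) ⟹ (&1 =' &2))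

/-- The theory `T_▷^I = T_▷ + B1 + B2 + B3 + B4`. -/
def TTriI : LTri.Theory := TTri ∪ {axB1, axB2, axB3, axB4}

end TriangularNumbers

namespace TriangularNumbers

/-- Universal quantification of the distinguished (`Sum.inr`) free variable. -/
def close1 {L : FirstOrder.Language.{u, v}} {α : Type u'} (φ : L.Formula (α ⊕ Fin 1)) :
    L.Formula α :=
  (BoundedFormula.relabel (Sum.elim Sum.inl (fun _ => Sum.inr (0 : Fin 1))) φ).all

/-- Universal closure of a formula with finitely many free variables. -/
def closeAll {L : FirstOrder.Language.{u, v}} {k : ℕ} (φ : L.Formula (Fin k)) : L.Sentence :=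
  (BoundedFormula.relabel (fun i => (Sum.inr i : Empty ⊕ Fin k)) φ).alls

/-- The induction axiom `Ind_x ψ` for a formula `ψ(x, z̄)`, where the induction variable `x`
is the `Sum.inr` variable and the parameters `z̄` are the `Sum.inl` variables:
`∀ z̄ (ψ(0,z̄) → ∀x (ψ(x,z̄) → ψ(s(x),z̄)) → ∀x ψ(x,z̄))`. -/
def indAxiom {L : FirstOrder.Language.{u, v}} (zero : L.Constants) (succ : L.Functions 1)
    {k : ℕ} (ψ : L.Formula (Fin k ⊕ Fin 1)) : L.Sentence :=
  closeAll
    ((ψ.subst (Sum.elim Term.var fun _ => Constants.term zero)).imp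
      ((close1 (ψ.imp
          (ψ.subst (Sum.elim (fun i => Term.var (Sum.inl i))
            fun _ => Functions.apply₁ succ (Term.var (Sum.inr 0)))))).imp
        (close1 ψ)))

/-- The theory `IOpen(L)` of induction for quantifier-free formulas. -/
def IOpenTh {L : FirstOrder.Language.{u, v}} (zero : L.Constants) (succ : L.Functions 1) :
    L.Theory :=
  { σ | ∃ (k : ℕ) (ψ : L.Formula (Fin k ⊕ Fin 1)), ψ.IsQF ∧ σ = indAxiom zero succ ψ }

end TriangularNumbers

namespace TriangularNumbers

section Semantics

variable {L : FirstOrder.Language.{u, v}} {M : Type*} [L.Structure M]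

theorem realize_close1 {α : Type u'} (φ : L.Formula (α ⊕ Fin 1)) (v : α → M) :
    (close1 φ).Realize v ↔ ∀ x, φ.Realize (Sum.elim v fun _ => x) := by
  simp only [close1, Formula.Realize, BoundedFormula.realize_all]
  refine forall_congr' fun x => ?_
  rw [BoundedFormula.realize_relabel]
  refine iff_of_eq (congrArg₂ _ ?_ (Subsingleton.elim _ _))
  funext i
  rcases i with i | i <;> simp [Fin.snoc]

theorem realize_closeAll {k : ℕ} (φ : L.Formula (Fin k)) :
    M ⊨ closeAll φ ↔ ∀ v : Fin k → M, φ.Realize v := by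
  refine BoundedFormula.realize_alls.trans (forall_congr' fun x => ?_)
  rw [BoundedFormula.realize_relabel, Formula.Realize]
  refine iff_of_eq (congrArg₂ _ ?_ (Subsingleton.elim _ _))
  funext i
  simp

theorem realize_indAxiom (zero : L.Constants) (succ : L.Functions 1) {k : ℕ}
    (ψ : L.Formula (Fin k ⊕ Fin 1)) :
    M ⊨ indAxiom zero succ ψ ↔ ∀ z : Fin k → M,
      ψ.Realize (Sum.elim z fun _ => (zero : M)) →
      (∀ x, ψ.Realize (Sum.elim z fun _ => x) →
        ψ.Realize (Sum.elim z fun _ => funMap succ ![x])) →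
      ∀ x, ψ.Realize (Sum.elim z fun _ => x) := by
  simp only [indAxiom, realize_closeAll, Formula.realize_imp, realize_close1]
  refine forall_congr' fun z => ?_
  have hsubst (τ : Fin k ⊕ Fin 1 → L.Term (Fin k)) :
      Formula.Realize (BoundedFormula.subst ψ τ) z ↔ ψ.Realize fun a => (τ a).realize z :=
    BoundedFormula.realize_subst
  have hsubst' (τ : Fin k ⊕ Fin 1 → L.Term (Fin k ⊕ Fin 1)) (w : Fin k ⊕ Fin 1 → M) :
      Formula.Realize (BoundedFormula.subst ψ τ) w ↔ ψ.Realize fun a => (τ a).realize w :=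
    BoundedFormula.realize_subst
  rw [hsubst]
  refine imp_congr (iff_of_eq (congrArg _ ?_)) (imp_congr (forall_congr' fun x =>
    imp_congr Iff.rfl ?_) Iff.rfl)
  · funext i
    rcases i with i | i <;> simp
  · rw [hsubst']
    refine iff_of_eq (congrArg _ ?_)
    funext i
    rcases i with i | i <;> simp [Term.realize_functions_apply₁]

end Semantics

section Interpretation

variable {M : Type*} [LTri.Structure M]

/-- The interpretation of `0`. -/
def zM : M := (fZero : M)
/-- The interpretation of `s`. -/
def sM (x : M) : M := funMap fSucc ![x]
/-- The interpretation of `p`. -/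
def pM (x : M) : M := funMap fPred ![x]
/-- The interpretation of `+`. -/
def aM (x y : M) : M := funMap fPlus ![x, y]
/-- The interpretation of `▷`. -/
def rM (x y : M) : Prop := RelMap rTri ![x, y]

variable {α : Type u'} (v : α → M)

@[simp] theorem realize_zT : (zT : LTri.Term α).realize v = zM := Term.realize_constants
@[simp] theorem realize_sT (t : LTri.Term α) : (sT t).realize v = sM (t.realize v) :=
  Term.realize_functions_apply₁
@[simp] theorem realize_pT (t : LTri.Term α) : (pT t).realize v = pM (t.realize v) :=
  Term.realize_functions_apply₁
@[simp] theorem realize_aT (t u : LTri.Term α) :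
    (aT t u).realize v = aM (t.realize v) (u.realize v) :=
  Term.realize_functions_apply₂
@[simp] theorem realize_rTri {n : ℕ} (t u : LTri.Term (α ⊕ Fin n)) (xs : Fin n → M) :
    (rTri.boundedFormula₂ t u).Realize v xs ↔
      rM (t.realize (Sum.elim v xs)) (u.realize (Sum.elim v xs)) :=
  BoundedFormula.realize_rel₂

variable (M)

/-- The semantic content of the axioms of `T_▷`. -/
structure IsTri : Prop where
  succ_ne : ∀ x : M, sM x ≠ zM
  pred_zero : pM (zM : M) = zM
  pred_succ : ∀ x : M, pM (sM x) = x
  add_zero : ∀ x : M, aM x zM = x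
  add_succ : ∀ x y : M, aM x (sM y) = sM (aM x y)
  tri_zero : rM (zM : M) zM
  tri_succ : ∀ x y : M, rM x y → rM (sM x) (aM (sM x) y)
  of_tri_succ : ∀ x y : M, rM (sM x) (aM (sM x) y) → rM x y
  tri_unique : ∀ x y z : M, rM x y → rM x z → y = z

/-- The semantic content of the axioms (B1)–(B4). -/
structure IsCancel : Prop where
  succ_pred : ∀ x : M, x ≠ zM → x = sM (pM x)
  add_comm : ∀ x y : M, aM x y = aM y x
  add_assoc : ∀ x y z : M, aM (aM x y) z = aM x (aM y z)
  add_left_cancel : ∀ x y z : M, aM x y = aM x z → y = z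

theorem model_TTri_iff : M ⊨ TTri ↔ IsTri M := by
  simp only [TTri, Theory.model_iff, Set.mem_insert_iff, Set.mem_singleton_iff,
    forall_eq_or_imp, forall_eq]
  simp only [Sentence.Realize, Formula.Realize, axA1, axA2, axA3, axA4, axA5, axA6, axA7, axA8,
    axA9, BoundedFormula.realize_all, BoundedFormula.realize_not, BoundedFormula.realize_imp,
    BoundedFormula.realize_inf, BoundedFormula.realize_bdEqual, realize_rTri, realize_zT,
    realize_sT, realize_pT, realize_aT]
  constructor
  · rintro ⟨h1, h2, h3, h4, h5, h6, h7, h8, h9⟩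
    exact ⟨h1, h2, h3, h4, h5, h6, h7, h8, fun x y z h h' => h9 x y z ⟨h, h'⟩⟩
  · rintro ⟨h1, h2, h3, h4, h5, h6, h7, h8, h9⟩
    exact ⟨h1, h2, h3, h4, h5, h6, h7, h8, fun x y z h => h9 x y z h.1 h.2⟩

theorem model_TTriI_iff : M ⊨ TTriI ↔ IsTri M ∧ IsCancel M := by
  rw [TTriI, Theory.model_union_iff, model_TTri_iff]
  refine and_congr Iff.rfl ?_
  simp only [Theory.model_iff, Set.mem_insert_iff, Set.mem_singleton_iff,
    forall_eq_or_imp, forall_eq]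
  simp only [Sentence.Realize, Formula.Realize, axB1, axB2, axB3, axB4,
    BoundedFormula.realize_all, BoundedFormula.realize_not, BoundedFormula.realize_imp,
    BoundedFormula.realize_bdEqual, realize_zT,
    realize_sT, realize_pT, realize_aT]
  constructor
  · rintro ⟨h1, h2, h3, h4⟩
    exact ⟨h1, h2, h3, h4⟩
  · rintro ⟨h1, h2, h3, h4⟩
    exact ⟨h1, h2, h3, h4⟩

/-- The semantic content of open induction: quantifier-free definable sets that contain `0` and
are closed under `s` are everything. -/
def HasOpenInd : Prop :=
  ∀ (k : ℕ) (ψ : LTri.Formula (Fin k ⊕ Fin 1)), ψ.IsQF → ∀ z : Fin k → M,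
    ψ.Realize (Sum.elim z fun _ => zM) →
    (∀ x, ψ.Realize (Sum.elim z fun _ => x) → ψ.Realize (Sum.elim z fun _ => sM x)) →
    ∀ x, ψ.Realize (Sum.elim z fun _ => x)

theorem model_IOpenTh_iff : M ⊨ IOpenTh fZero fSucc ↔ HasOpenInd M := by
  simp only [Theory.model_iff, IOpenTh, Set.mem_ofPred_eq]
  constructor
  · intro h k ψ hψ
    exact (realize_indAxiom fZero fSucc ψ).1 (h _ ⟨k, ψ, hψ, rfl⟩)
  · rintro h _ ⟨k, ψ, hψ, rfl⟩
    exact (realize_indAxiom fZero fSucc ψ).2 (h k ψ hψ)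

end Interpretation

section OfInduction

variable {M : Type*} [LTri.Structure M]

theorem HasOpenInd.equation (h : HasOpenInd M) {k : ℕ} (t u : LTri.Term (Fin k ⊕ Fin 1))
    (z : Fin k → M)
    (h0 : t.realize (Sum.elim z fun _ => zM) = u.realize (Sum.elim z fun _ => zM))
    (hs : ∀ x, t.realize (Sum.elim z fun _ => x) = u.realize (Sum.elim z fun _ => x) →
      t.realize (Sum.elim z fun _ => sM x) = u.realize (Sum.elim z fun _ => sM x)) (x : M) :
    t.realize (Sum.elim z fun _ => x) = u.realize (Sum.elim z fun _ => x) := by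
  have := h k (t.equal u) (BoundedFormula.IsAtomic.equal _ _).isQF z
  simp only [Formula.realize_equal] at this
  exact this h0 hs x

theorem HasOpenInd.implication (h : HasOpenInd M) {k : ℕ}
    (t u t' u' : LTri.Term (Fin k ⊕ Fin 1)) (z : Fin k → M) :
    let P (x : M) := t.realize (Sum.elim z fun _ => x) = u.realize (Sum.elim z fun _ => x) →
      t'.realize (Sum.elim z fun _ => x) = u'.realize (Sum.elim z fun _ => x)
    P zM → (∀ x, P x → P (sM x)) → ∀ x, P x := by
  have := h k ((t.equal u).imp (t'.equal u')) (BoundedFormula.IsQF.imp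
    (BoundedFormula.IsAtomic.equal _ _).isQF (BoundedFormula.IsAtomic.equal _ _).isQF) z
  simpa only [Formula.realize_equal, Formula.realize_imp] using this

theorem HasOpenInd.isCancel (h : HasOpenInd M) (hM : IsTri M) : IsCancel M := by
  let X {k : ℕ} : LTri.Term (Fin k ⊕ Fin 1) := Term.var (Sum.inr 0)
  let Z {k : ℕ} (i : Fin k) : LTri.Term (Fin k ⊕ Fin 1) := Term.var (Sum.inl i)
  have sinj (x y : M) (hxy : sM x = sM y) : x = y := by
    rw [← hM.pred_succ x, hxy, hM.pred_succ]
  have zero_add (x : M) : aM zM x = x := by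
    have := h.equation (aT zT X) X ![]
    simp only [X, realize_aT, realize_zT, Term.realize_var, Sum.elim_inr] at this
    exact this (hM.add_zero _) (fun x hx => by rw [hM.add_succ, hx]) x
  have succ_add (x y : M) : aM (sM x) y = sM (aM x y) := by
    have := h.equation (aT (sT (Z 0)) X) (sT (aT (Z 0) X)) ![x]
    simp only [X, Z, realize_aT, realize_sT, Term.realize_var, Sum.elim_inr, Sum.elim_inl,
      Matrix.cons_val_zero] at this
    exact this (by rw [hM.add_zero, hM.add_zero])
      (fun y hy => by rw [hM.add_succ, hM.add_succ, hy]) y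
  refine ⟨fun x => ?_, fun x y => ?_, fun x y z => ?_, fun x y z => ?_⟩
  · have := h 0 ((∼(X.equal zT)).imp (X.equal (sT (pT X)))) (BoundedFormula.IsQF.imp
      (BoundedFormula.IsAtomic.equal _ _).isQF.not (BoundedFormula.IsAtomic.equal _ _).isQF) ![]
    simp only [X, Formula.realize_imp, Formula.realize_not, Formula.realize_equal, realize_zT,
      realize_sT, realize_pT, Term.realize_var, Sum.elim_inr] at this
    exact this (fun h => absurd trivial h) (fun x _ _ => by rw [hM.pred_succ]) x
  · have := h.equation (aT (Z 0) X) (aT X (Z 0)) ![x]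
    simp only [X, Z, realize_aT, Term.realize_var, Sum.elim_inr, Sum.elim_inl,
      Matrix.cons_val_zero] at this
    exact this (by rw [hM.add_zero, zero_add]) (fun y hy => by rw [hM.add_succ, succ_add, hy]) y
  · have := h.equation (aT (aT (Z 0) (Z 1)) X) (aT (Z 0) (aT (Z 1) X)) ![x, y]
    simp only [X, Z, realize_aT, Term.realize_var, Sum.elim_inr, Sum.elim_inl,
      Matrix.cons_val_zero, Matrix.cons_val_one] at this
    exact this (by rw [hM.add_zero, hM.add_zero])
      (fun z hz => by rw [hM.add_succ, hM.add_succ, hM.add_succ, hz]) z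
  · have := h.implication (aT X (Z 0)) (aT X (Z 1)) (Z 0) (Z 1) ![y, z]
    simp only [X, Z, realize_aT, Term.realize_var, Sum.elim_inr, Sum.elim_inl,
      Matrix.cons_val_zero, Matrix.cons_val_one] at this
    refine this (fun h => ?_) (fun x ih h => ih ?_) x
    · rwa [zero_add, zero_add] at h
    · rw [succ_add, succ_add] at h
      exact sinj _ _ h

end OfInduction

section Monoid

variable {M : Type*} [AddCancelCommMonoid M] {e : M}

theorem le_of_add_nsmul_eq (he : ∀ x : M, x + e ≠ 0) {x : M} {t u : ℕ}
    (h : x + t • e = u • e) : t ≤ u := by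
  by_contra! hlt
  obtain ⟨d, rfl⟩ := Nat.exists_eq_add_of_lt hlt
  refine he (x + d • e) (add_left_cancel (a := u • e) ?_)
  rw [add_zero, ← add_assoc]
  refine Eq.trans ?_ h
  rw [add_nsmul, add_nsmul, one_nsmul]
  abel

theorem nsmul_injective_of_add_ne_zero (he : ∀ x : M, x + e ≠ 0) {m n : ℕ}
    (h : m • e = n • e) : m = n :=
  le_antisymm (le_of_add_nsmul_eq he (x := 0) (by rw [zero_add, h]))
    (le_of_add_nsmul_eq he (x := 0) (by rw [zero_add, h]))

/-- From some multiple of `e` on, `f` is an affine function with a natural slope. -/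
def EvLinear (e : M) (f : M → M) : Prop :=
  ∃ (N k : ℕ) (c : M), ∀ x, f (x + N • e) = k • x + c

theorem EvLinear.const (c : M) : EvLinear e fun _ => c :=
  ⟨0, 0, c, fun x => by simp⟩

theorem EvLinear.id : EvLinear e fun x => x :=
  ⟨0, 1, 0, fun x => by simp⟩

theorem EvLinear.common {f g : M → M} (hf : EvLinear e f) (hg : EvLinear e g) :
    ∃ (N k l : ℕ) (c d : M), ∀ x, f (x + N • e) = k • x + c ∧ g (x + N • e) = l • x + d := by
  obtain ⟨N, k, c, hf⟩ := hf
  obtain ⟨N', l, d, hg⟩ := hg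
  refine ⟨N + N', k, l, k • N' • e + c, l • N • e + d, fun x => ⟨?_, ?_⟩⟩
  · rw [show x + (N + N') • e = x + N' • e + N • e by rw [add_nsmul]; abel, hf, nsmul_add,
      add_assoc]
  · rw [add_nsmul, ← add_assoc, hg, nsmul_add, add_assoc]

theorem EvLinear.add {f g : M → M} (hf : EvLinear e f) (hg : EvLinear e g) :
    EvLinear e fun x => f x + g x := by
  obtain ⟨N, k, l, c, d, h⟩ := hf.common hg
  refine ⟨N, k + l, c + d, fun x => ?_⟩
  simp only [h x, add_nsmul]
  abel

theorem EvLinear.pred {p : M → M} (hp : ∀ x, p (x + e) = x) {f : M → M} (hf : EvLinear e f) :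
    EvLinear e fun x => p (f x) := by
  obtain ⟨N, k, c, h⟩ := hf
  rcases k with _ | k
  · exact ⟨N, 0, p c, fun x => by simp [h]⟩
  · refine ⟨N + 1, k + 1, k • e + c, fun x => ?_⟩
    simp only [show x + (N + 1) • e = x + e + N • e by rw [succ_nsmul]; abel, h,
      show (k + 1) • (x + e) + c = (k + 1) • x + (k • e + c) + e by
        simp only [nsmul_add, succ_nsmul]; abel, hp]

/-- From some multiple of `e` on, `P` either always holds, or holds only within a window of
bounded length on each chain `x, x + e, x + 2 • e, …`. -/
def EvWindow (e : M) (P : M → Prop) : Prop :=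
  ∃ N B : ℕ, (∀ x, P (x + N • e)) ∨
    ∀ (x : M) (m : ℕ), B ≤ m → P (x + N • e) → ¬P (x + m • e + N • e)

theorem EvLinear.eq (he : ∀ x : M, x + e ≠ 0) {f g : M → M} (hf : EvLinear e f)
    (hg : EvLinear e g) : EvWindow e fun x => f x = g x := by
  obtain ⟨N, k, l, c, d, h⟩ := hf.common hg
  refine ⟨N, 1, ?_⟩
  simp only [fun x => (h x).1, fun x => (h x).2]
  by_cases hkl : k = l
  · subst hkl
    by_cases hcd : c = d
    · exact Or.inl fun x => by rw [hcd]
    · exact Or.inr fun x m _ h _ => hcd (add_left_cancel h)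
  · refine Or.inr fun x m hm h1 h2 => hkl ?_
    have : (k * m) • e = (l * m) • e := by
      refine add_left_cancel (a := k • x + c) ?_
      calc k • x + c + (k * m) • e = k • (x + m • e) + c := by rw [mul_nsmul', nsmul_add]; abel
        _ = l • (x + m • e) + d := h2
        _ = l • x + d + (l * m) • e := by rw [mul_nsmul', nsmul_add]; abel
        _ = k • x + c + (l * m) • e := by rw [h1]
    exact Nat.eq_of_mul_eq_mul_right hm (nsmul_injective_of_add_ne_zero he this)

theorem tri_add_nsmul {R : M → M → Prop} (hR : ∀ x y, R x y → R (x + e) (x + e + y)) {a y : M}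
    (h : R a y) (j : ℕ) : R (a + j • e) (y + j • a + (∑ i ∈ Finset.range (j + 1), i) • e) := by
  induction j with
  | zero => simpa using h
  | succ j ih =>
    convert hR _ _ ih using 1
    · rw [succ_nsmul, add_assoc]
    · rw [Finset.sum_range_succ, add_nsmul e _ (j + 1), succ_nsmul a, succ_nsmul e]
      abel

theorem EvLinear.tri (he : ∀ x : M, x + e ≠ 0) {R : M → M → Prop}
    (hR : ∀ x y, R x y → R (x + e) (x + e + y)) (hu : ∀ x y z, R x y → R x z → y = z)
    {f g : M → M} (hf : EvLinear e f) (hg : EvLinear e g) : EvWindow e fun x => R (f x) (g x) := by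
  obtain ⟨N, k, l, c, d, h⟩ := hf.common hg
  refine ⟨N, 2 * l + 1, ?_⟩
  simp only [fun x => (h x).1, fun x => (h x).2]
  by_cases hkl : k = 0 ∧ l = 0
  · obtain ⟨rfl, rfl⟩ := hkl
    simp only [zero_nsmul, zero_add]
    by_cases hcd : R c d
    · exact Or.inl fun _ => hcd
    · exact Or.inr fun _ _ _ h => absurd h hcd
  · refine Or.inr fun x m hm h1 h2 => ?_
    have h3 := tri_add_nsmul hR h1 (k * m)
    rw [show k • x + c + (k * m) • e = k • (x + m • e) + c by rw [mul_nsmul', nsmul_add]; abel]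
      at h3
    have h4 : (k * m) • (k • x + c) + (∑ i ∈ Finset.range (k * m + 1), i) • e = (l * m) • e := by
      refine add_left_cancel (a := l • x + d) ?_
      rw [← add_assoc, hu _ _ _ h3 h2, mul_nsmul', nsmul_add]
      abel
    rcases Nat.eq_zero_or_pos k with rfl | hk
    · have h5 : 0 • e = (l * m) • e := by simpa using h4
      have := nsmul_injective_of_add_ne_zero he h5
      rcases Nat.mul_eq_zero.1 this.symm with hl | hm0
      · exact hkl ⟨rfl, hl⟩
      · omega
    · have h5 := le_of_add_nsmul_eq he h4
      have h6 := Finset.sum_range_id_mul_two (k * m + 1)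
      rw [Nat.add_sub_cancel] at h6
      have h7 : m ≤ k * m := Nat.le_mul_of_pos_left m hk
      nlinarith [Nat.mul_le_mul (Nat.succ_le_succ h7) h7]

/-- Along the multiples of `e` and along the descending sequence `b`, the truth value of `P` is
eventually constant, with the same limit. -/
def EvDecided (e : M) (b : ℕ → M) (P : M → Prop) : Prop :=
  ∃ v : Prop, ∀ᶠ n : ℕ in Filter.atTop, (P (n • e) ↔ v) ∧ (P (b n) ↔ v)

theorem EvDecided.imp {b : ℕ → M} {P Q : M → Prop} (hP : EvDecided e b P)
    (hQ : EvDecided e b Q) : EvDecided e b fun x => P x → Q x := by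
  obtain ⟨v, hv⟩ := hP
  obtain ⟨w, hw⟩ := hQ
  refine ⟨v → w, ?_⟩
  filter_upwards [hv, hw] with n h h'
  exact ⟨imp_congr h.1 h'.1, imp_congr h.2 h'.2⟩

theorem eventually_not_of_window {P : ℕ → Prop} {B : ℕ}
    (h : ∀ n m, B ≤ m → P n → ¬P (n + m)) : ∀ᶠ n in Filter.atTop, ¬P n := by
  by_cases hP : ∃ n, P n
  · obtain ⟨n, hn⟩ := hP
    filter_upwards [Filter.eventually_ge_atTop (n + B)] with m hm
    obtain ⟨d, rfl⟩ := Nat.exists_eq_add_of_le hm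
    rw [add_assoc]
    exact h n _ (Nat.le_add_right _ _) hn
  · exact Filter.Eventually.of_forall fun n hn => hP ⟨n, hn⟩

theorem EvWindow.evDecided {b : ℕ → M} (hb : ∀ n, b n = b (n + 1) + e) {P : M → Prop}
    (hP : EvWindow e P) : EvDecided e b P := by
  have hb' (n m : ℕ) : b n = b (n + m) + m • e := by
    induction m with
    | zero => simp
    | succ m ih => rw [ih, hb (n + m), succ_nsmul, ← add_assoc n]; abel
  obtain ⟨N, B, h | h⟩ := hP
  · refine ⟨True, ?_⟩
    filter_upwards [Filter.eventually_ge_atTop N] with n hn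
    obtain ⟨d, rfl⟩ := Nat.exists_eq_add_of_le' hn
    simp only [iff_true]
    exact ⟨by rw [add_nsmul]; exact h _, by rw [hb' _ N]; exact h _⟩
  · refine ⟨False, ?_⟩
    simp only [iff_false]
    refine Filter.Eventually.and ?_ (eventually_not_of_window (B := B) fun n m hm h1 h2 => ?_)
    · rw [← Filter.map_add_atTop_eq_nat N, Filter.eventually_map]
      refine eventually_not_of_window (B := B) fun n m hm h1 h2 => ?_
      rw [add_nsmul] at h1
      rw [add_nsmul, add_nsmul] at h2
      exact h _ m hm h1 h2
    · rw [hb' _ N] at h2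
      refine h _ m hm h2 ?_
      convert h1 using 1
      rw [hb' n m, hb' (n + m) N]
      abel

end Monoid

section ToInduction

variable {M : Type*} [LTri.Structure M]

/-- The additive structure of a model of `T_▷^I`. -/
abbrev IsCancel.addCancelCommMonoid (hC : IsCancel M) (hM : IsTri M) :
    AddCancelCommMonoid M :=
  letI : Zero M := ⟨zM⟩
  letI : Add M := ⟨aM⟩
  { add_assoc := hC.add_assoc
    zero_add := fun x => (hC.add_comm _ _).trans (hM.add_zero x)
    add_zero := hM.add_zero
    add_comm := hC.add_comm
    add_left_cancel := fun x y z h => hC.add_left_cancel x y z h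
    nsmul := nsmulRec }

/-- A monoid structure that agrees with the interpretation of `0`, `s` and `+`, where `e` plays
the role of `s(0)`. -/
structure Compatible (M : Type*) [LTri.Structure M] [AddCancelCommMonoid M] (e : M) : Prop where
  zero_eq : (zM : M) = 0
  succ_eq : ∀ x : M, sM x = x + e
  add_eq : ∀ x y : M, aM x y = x + y

theorem IsCancel.compatible (hC : IsCancel M) (hM : IsTri M) :
    letI := hC.addCancelCommMonoid hM
    Compatible M (sM zM) :=
  letI := hC.addCancelCommMonoid hM
  { zero_eq := rfl
    succ_eq := fun x => ((hM.add_succ x zM).trans (by rw [hM.add_zero])).symm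
    add_eq := fun _ _ => rfl }

variable [AddCancelCommMonoid M] {e : M}

theorem Compatible.evLinear_term (h : Compatible M e) (hM : IsTri M) {α : Type u'}
    (t : LTri.Term α) {V : M → α → M} (hV : ∀ a, EvLinear e fun x => V x a) :
    EvLinear e fun x => t.realize (V x) := by
  induction t with
  | var a => exact hV a
  | func f ts ih =>
    cases f with
    | zero =>
      have (x : M) : (Term.func TriFunc.zero ts : LTri.Term α).realize (V x) = zM :=
        congrArg (funMap fZero) (Subsingleton.elim _ _)
      simp only [this]
      exact EvLinear.const _
    | succ =>
      have (x : M) : (Term.func TriFunc.succ ts : LTri.Term α).realize (V x) =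
          (ts 0).realize (V x) + e :=
        (congrArg (funMap fSucc) (funext fun i => by fin_cases i; rfl)).trans (h.succ_eq _)
      simp only [this]
      exact (ih 0).add (EvLinear.const _)
    | pred =>
      have (x : M) : (Term.func TriFunc.pred ts : LTri.Term α).realize (V x) =
          pM ((ts 0).realize (V x)) :=
        congrArg (funMap fPred) (funext fun i => by fin_cases i; rfl)
      simp only [this]
      exact (ih 0).pred fun x => by rw [← h.succ_eq, hM.pred_succ]
    | plus =>
      have (x : M) : (Term.func TriFunc.plus ts : LTri.Term α).realize (V x) =
          (ts 0).realize (V x) + (ts 1).realize (V x) :=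
        (congrArg (funMap fPlus) (funext fun i => by fin_cases i <;> rfl)).trans (h.add_eq _ _)
      simp only [this]
      exact (ih 0).add (ih 1)

theorem Compatible.add_ne_zero (h : Compatible M e) (hM : IsTri M) (x : M) : x + e ≠ 0 := by
  rw [← h.succ_eq, ← h.zero_eq]
  exact hM.succ_ne x

theorem Compatible.evWindow_atomic (h : Compatible M e) (hM : IsTri M) {α : Type u'} {n : ℕ}
    {ψ : LTri.BoundedFormula α n} (hψ : ψ.IsAtomic) {V : M → α → M} {W : M → Fin n → M}
    (hV : ∀ a, EvLinear e fun x => V x a) (hW : ∀ a, EvLinear e fun x => W x a) :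
    EvWindow e fun x => ψ.Realize (V x) (W x) := by
  have hVW : ∀ a, EvLinear e fun x => Sum.elim (V x) (W x) a := by
    rintro (a | a)
    · exact hV a
    · exact hW a
  cases hψ with
  | equal t u =>
    simp only [BoundedFormula.realize_bdEqual]
    exact (h.evLinear_term hM t hVW).eq (h.add_ne_zero hM) (h.evLinear_term hM u hVW)
  | rel R ts =>
    cases R with
    | tri =>
      have (x : M) : (Relations.boundedFormula (L := LTri) TriRel.tri ts).Realize (V x) (W x) ↔
          rM ((ts 0).realize (Sum.elim (V x) (W x))) ((ts 1).realize (Sum.elim (V x) (W x))) :=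
        iff_of_eq (congrArg (RelMap rTri) (funext fun i => by fin_cases i <;> rfl))
      simp only [this]
      refine (h.evLinear_term hM _ hVW).tri (h.add_ne_zero hM) (fun x y hxy => ?_) hM.tri_unique
        (h.evLinear_term hM _ hVW)
      rw [← h.succ_eq, ← h.add_eq]
      exact hM.tri_succ x y hxy

theorem Compatible.evDecided (h : Compatible M e) (hM : IsTri M) {α : Type u'} {n : ℕ}
    {ψ : LTri.BoundedFormula α n} (hψ : ψ.IsQF) {V : M → α → M} {W : M → Fin n → M}
    (hV : ∀ a, EvLinear e fun x => V x a) (hW : ∀ a, EvLinear e fun x => W x a)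
    {b : ℕ → M} (hb : ∀ n, b n = b (n + 1) + e) :
    EvDecided e b fun x => ψ.Realize (V x) (W x) := by
  induction hψ with
  | falsum => exact ⟨False, Filter.Eventually.of_forall fun _ => ⟨Iff.rfl, Iff.rfl⟩⟩
  | of_isAtomic hψ => exact (h.evWindow_atomic hM hψ hV hW).evDecided hb
  | imp _ _ ih ih' => exact ih.imp ih'

theorem Compatible.hasOpenInd (h : Compatible M e) (hM : IsTri M) (hC : IsCancel M) :
    HasOpenInd M := by
  intro k ψ hψ z h0 hs x
  by_contra hx
  have hb (n : ℕ) : ¬ψ.Realize (Sum.elim z fun _ => pM^[n] x) ∧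
      pM^[n] x = pM^[n + 1] x + e := by
    have step (y : M) (hy : ¬ψ.Realize (Sum.elim z fun _ => y)) : y = sM (pM y) :=
      hC.succ_pred y fun hy0 => hy (hy0 ▸ h0)
    have hn : ¬ψ.Realize (Sum.elim z fun _ => pM^[n] x) := by
      induction n with
      | zero => exact hx
      | succ n ih =>
        rw [Function.iterate_succ_apply']
        intro hp
        refine ih ?_
        rw [step _ ih]
        exact hs _ hp
    refine ⟨hn, ?_⟩
    rw [Function.iterate_succ_apply', ← h.succ_eq]
    exact step _ hn
  have hstd (n : ℕ) : ψ.Realize (Sum.elim z fun _ => n • e) := by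
    induction n with
    | zero => rwa [zero_nsmul, ← h.zero_eq]
    | succ n ih =>
      rw [succ_nsmul, ← h.succ_eq]
      exact hs _ ih
  obtain ⟨v, hv⟩ := h.evDecided hM hψ (V := fun y => Sum.elim z fun _ => y)
    (W := fun _ => default)
    (by rintro (a | a); exacts [EvLinear.const _, EvLinear.id]) (fun a => a.elim0)
    fun n => (hb n).2
  obtain ⟨n, h1, h2⟩ := hv.exists
  exact (hb n).1 (h2.2 (h1.1 (hstd n)))

end ToInduction

theorem model_openInd_iff (M : Type*) [LTri.Structure M] :
    M ⊨ TTri ∪ IOpenTh fZero fSucc ↔ M ⊨ TTriI := by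
  rw [Theory.model_union_iff, model_TTri_iff, model_IOpenTh_iff, model_TTriI_iff]
  refine and_congr_right fun hM => ⟨fun h => h.isCancel hM, fun hC => ?_⟩
  let := hC.addCancelCommMonoid hM
  exact (hC.compatible hM).hasOpenInd hM hC

/-- For every `L_▷`-formula `φ`: `T_▷ + IOpen(L_▷) ⊢ φ` if and only if
`T_▷^I ⊢ φ`. In particular, the theory `T_▷ + IOpen(L_▷)` is finitely axiomatized by the
universal theory `T_▷^I`. -/
theorem statement12 {α : Type} (φ : LTri.Formula α) :
    (TTri ∪ IOpenTh fZero fSucc) ⊨ᵇ φ ↔ TTriI ⊨ᵇ φ := by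
  constructor
  · intro h M v xs
    have := (model_openInd_iff M).2 M.is_model
    exact h (Theory.ModelType.of _ M) v xs
  · intro h M v xs
    have := (model_openInd_iff M).1 M.is_model
    exact h (Theory.ModelType.of _ M) v xs

end TriangularNumbers
end
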